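/- Let $T>0$, let $\mu,\gamma$ be real with $0\le\mu<1$, $\gamma>0$, $\mu+\gamma\ge 1$, let $\varepsilon\in(0,1]$, and let $y_0\in\mathbb{R}$. Let $p_1,q_1,g_1:[0,T]\to\mathbb{R}$ be continuous and let $K_1,K_2$ be real-valued continuous functions on the triangle $D=\{(t,s):0\le s\le t\le T\}$. Then there exists a unique continuously differentiable function $y:[0,T]\to\mathbb{R}$ with $y(0)=y_0$ such that for every $t\in(0,T]$, $$y'(t)=p_1(t)y(t)+q_1(t)y(\varepsilon t)+g_1(t)+t^{-\gamma}\int_0^t(t-s)^{-\mu}s^{\mu+\gamma-1}K_1(t,s)y(s)\,ds+(\varepsilon t)^{-\gamma}\int_0^{\varepsilon t}(\varepsilon t-\tau)^{-\mu}\tau^{\mu+\gamma-1}K_2(t,\tau)y(\tau)\,d\tau.$$ Furthermore, for every integer $m\ge 0$, if $p_1,q_1,g_1\in C^m[0,T]$ and $K_1,K_2\in C^m(D)$, then this solution satisfies $y\in C^{m+1}[0,T]$. -/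

import Mathlib

open Set MeasureTheory

/-- The closed triangle `D = {(t, s) : 0 ≤ s ≤ t ≤ T}`. -/
def cordialTriangle (T : ℝ) : Set (ℝ × ℝ) :=
  {p : ℝ × ℝ | 0 ≤ p.2 ∧ p.2 ≤ p.1 ∧ p.1 ≤ T}

/-- The right-hand side of the third-kind (cordial) Volterra integro-differential
equation with weakly singular kernels and proportional delay: the sum of five terms, the last
two being the cordial operators with kernels `K₁` and `K₂`. -/
noncomputable def cordialRHS (μ γ ε : ℝ) (p₁ q₁ g₁ : ℝ → ℝ) (K₁ K₂ : ℝ → ℝ → ℝ)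
    (y : ℝ → ℝ) (t : ℝ) : ℝ :=
  p₁ t * y t + q₁ t * y (ε * t) + g₁ t
    + (t ^ (-γ) *
        (∫ s in (0:ℝ)..t, ((t - s) ^ (-μ) * s ^ (μ + γ - 1) * K₁ t s * y s)))
    + ((ε * t) ^ (-γ) *
        (∫ τ in (0:ℝ)..(ε * t), ((ε * t - τ) ^ (-μ) * τ ^ (μ + γ - 1) * K₂ t τ * y τ)))

/-- `y` is a continuously differentiable solution on `[0, T]` of the delayed cordial
Volterra integro-differential equation with initial value `y₀`. Derivatives at the endpoints
are one-sided; only the values of `y` on `[0, T]` matter. -/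
def IsCordialSolution (μ γ ε y₀ T : ℝ) (p₁ q₁ g₁ : ℝ → ℝ) (K₁ K₂ : ℝ → ℝ → ℝ)
    (y : ℝ → ℝ) : Prop :=
  ∃ y' : ℝ → ℝ, ContinuousOn y' (Icc 0 T)
    ∧ (∀ t ∈ Icc (0:ℝ) T, HasDerivWithinAt y (y' t) (Icc 0 T) t)
    ∧ y 0 = y₀
    ∧ ∀ t ∈ Ioc (0:ℝ) T, y' t = cordialRHS μ γ ε p₁ q₁ g₁ K₁ K₂ y t

theorem continuousOn_weighted_integral {T : ℝ} {w : ℝ → ℝ} {f : ℝ × ℝ → ℝ}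
    (hw : IntervalIntegrable w volume 0 1)
    (hf : ContinuousOn f (Icc 0 T ×ˢ Icc 0 1)) :
    ContinuousOn (fun t => ∫ x in (0:ℝ)..1, w x * f (t, x)) (Icc 0 T) := by
  obtain ⟨C, hC⟩ := (isCompact_Icc.prod isCompact_Icc).exists_bound_of_continuousOn hf
  intro t₀ ht₀
  have hsub : ∀ x ∈ uIoc (0:ℝ) 1, x ∈ Icc (0:ℝ) 1 := fun x hx => by
    rw [uIoc_of_le zero_le_one] at hx
    exact Ioc_subset_Icc_self hx
  refine intervalIntegral.continuousWithinAt_of_dominated_interval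
    (bound := fun x => ‖w x‖ * C) ?_ ?_ (hw.norm.mul_const C) ?_
  · filter_upwards [self_mem_nhdsWithin] with t ht
    refine (intervalIntegrable_iff.1 (hw.mul_continuousOn ?_)).aestronglyMeasurable
    rw [uIcc_of_le zero_le_one]
    exact hf.comp (by fun_prop) fun x hx => ⟨ht, hx⟩
  · filter_upwards [self_mem_nhdsWithin] with t ht
    refine Filter.Eventually.of_forall fun x hx => ?_
    rw [norm_mul]
    exact mul_le_mul_of_nonneg_left (hC (t, x) ⟨ht, hsub x hx⟩) (norm_nonneg _)
  · refine Filter.Eventually.of_forall fun x hx => ?_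
    have h : ContinuousOn (fun t => f (t, x)) (Icc 0 T) :=
      hf.comp (by fun_prop) fun t ht => ⟨ht, hsub x hx⟩
    exact continuousWithinAt_const.mul (h t₀ ht₀)

theorem hasDerivWithinAt_weighted_integral {T : ℝ} {w : ℝ → ℝ} {f f' : ℝ × ℝ → ℝ}
    (hw : IntervalIntegrable w volume 0 1)
    (hf : ContinuousOn f (Icc 0 T ×ˢ Icc 0 1))
    (hf' : ContinuousOn f' (Icc 0 T ×ˢ Icc 0 1))
    (hderiv : ∀ t ∈ Icc 0 T, ∀ x ∈ Icc (0:ℝ) 1,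
      HasDerivWithinAt (fun t => f (t, x)) (f' (t, x)) (Icc 0 T) t)
    {t₀ : ℝ} (ht₀ : t₀ ∈ Icc 0 T) :
    HasDerivWithinAt (fun t => ∫ x in (0:ℝ)..1, w x * f (t, x))
      (∫ x in (0:ℝ)..1, w x * f' (t₀, x)) (Icc 0 T) t₀ := by
  obtain ⟨C, hC⟩ := (isCompact_Icc.prod isCompact_Icc).exists_bound_of_continuousOn hf'
  have hsub : ∀ x ∈ uIoc (0:ℝ) 1, x ∈ Icc (0:ℝ) 1 := fun x hx => by
    rw [uIoc_of_le zero_le_one] at hx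
    exact Ioc_subset_Icc_self hx
  have hint : ∀ t ∈ Icc 0 T, IntervalIntegrable (fun x => w x * f (t, x)) volume 0 1 := by
    intro t ht
    refine hw.mul_continuousOn ?_
    rw [uIcc_of_le zero_le_one]
    exact hf.comp (by fun_prop) fun x hx => ⟨ht, hx⟩
  have hslope : ∀ t ∈ Icc 0 T, slope (fun t => ∫ x in (0:ℝ)..1, w x * f (t, x)) t₀ t
      = ∫ x in (0:ℝ)..1, w x * slope (fun t => f (t, x)) t₀ t := by
    intro t ht
    rw [slope_def_field, ← intervalIntegral.integral_sub (hint t ht) (hint t₀ ht₀),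
      ← intervalIntegral.integral_div]
    refine intervalIntegral.integral_congr fun x _ => ?_
    simp only [slope_def_field]
    ring
  rw [hasDerivWithinAt_iff_tendsto_slope]
  have hmem : ∀ᶠ t in nhdsWithin t₀ (Icc 0 T \ {t₀}), t ∈ Icc 0 T := by
    filter_upwards [self_mem_nhdsWithin] with t ht using ht.1
  refine Filter.Tendsto.congr' (hmem.mono fun t ht => (hslope t ht).symm) ?_
  refine intervalIntegral.tendsto_integral_filter_of_dominated_convergence
    (fun x => ‖w x‖ * C) ?_ ?_ (hw.norm.mul_const C) ?_
  · filter_upwards [hmem] with t ht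
    refine (intervalIntegrable_iff.1 (hw.mul_continuousOn ?_)).aestronglyMeasurable
    rw [uIcc_of_le zero_le_one]
    simp only [slope_def_field]
    have h : ∀ s ∈ Icc 0 T, ContinuousOn (fun x => f (s, x)) (Icc 0 1) := fun s hs =>
      hf.comp (by fun_prop) fun x hx => ⟨hs, hx⟩
    exact ((h t ht).sub (h t₀ ht₀)).div_const _
  · filter_upwards [self_mem_nhdsWithin] with t ht
    refine Filter.Eventually.of_forall fun x hx => ?_
    rw [norm_mul]
    refine mul_le_mul_of_nonneg_left ?_ (norm_nonneg _)
    have hb := (convex_Icc 0 T).norm_image_sub_le_of_norm_hasDerivWithin_le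
      (fun s hs => hderiv s hs x (hsub x hx)) (fun s hs => hC (s, x) ⟨hs, hsub x hx⟩) ht₀ ht.1
    have hpos : 0 < ‖t - t₀‖ := norm_pos_iff.2 (sub_ne_zero.2 ht.2)
    rw [slope_def_field, norm_div, div_le_iff₀ hpos]
    exact hb
  · refine Filter.Eventually.of_forall fun x hx => ?_
    exact ((hasDerivWithinAt_iff_tendsto_slope).1
      (hderiv t₀ ht₀ x (hsub x hx))).const_mul (w x)

theorem contDiffOn_weighted_integral {T : ℝ} (hT : 0 < T) {w : ℝ → ℝ}
    (hw : IntervalIntegrable w volume 0 1) (m : ℕ) {f : ℝ × ℝ → ℝ}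
    (hf : ContDiffOn ℝ m f (Icc 0 T ×ˢ Icc 0 1)) :
    ContDiffOn ℝ m (fun t => ∫ x in (0:ℝ)..1, w x * f (t, x)) (Icc 0 T) := by
  induction m generalizing f with
  | zero =>
    rw [Nat.cast_zero, contDiffOn_zero] at hf ⊢
    exact continuousOn_weighted_integral hw hf
  | succ m ih =>
    have hT' : UniqueDiffOn ℝ (Icc 0 T) := uniqueDiffOn_Icc hT
    have hR : UniqueDiffOn ℝ (Icc 0 T ×ˢ Icc (0:ℝ) 1) := hT'.prod (uniqueDiffOn_Icc one_pos)
    have hf' : ContDiffOn ℝ m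
        (fun p => fderivWithin ℝ f (Icc 0 T ×ˢ Icc 0 1) p (1, 0)) (Icc 0 T ×ˢ Icc 0 1) :=
      (hf.fderivWithin hR (by norm_cast)).clm_apply contDiffOn_const
    have hd : ∀ t ∈ Icc 0 T, HasDerivWithinAt (fun t => ∫ x in (0:ℝ)..1, w x * f (t, x))
        (∫ x in (0:ℝ)..1, w x * fderivWithin ℝ f (Icc 0 T ×ˢ Icc 0 1) (t, x) (1, 0))
        (Icc 0 T) t := by
      intro t ht
      refine hasDerivWithinAt_weighted_integral
        (f' := fun p => fderivWithin ℝ f (Icc 0 T ×ˢ Icc 0 1) p (1, 0))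
        hw hf.continuousOn hf'.continuousOn (fun s hs x hx => ?_) ht
      have h1 := (hf.differentiableOn (by simp) (s, x) ⟨hs, hx⟩).hasFDerivWithinAt
      have h2 : HasDerivWithinAt (fun s : ℝ => (s, x)) ((1:ℝ), (0:ℝ)) (Icc 0 T) s :=
        (hasDerivWithinAt_id s _).prodMk (hasDerivWithinAt_const s _ x)
      have h3 : MapsTo (fun s : ℝ => (s, x)) (Icc 0 T) (Icc 0 T ×ˢ Icc (0:ℝ) 1) :=
        fun r hr => ⟨hr, hx⟩
      exact h1.comp_hasDerivWithinAt s h2 h3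
    rw [Nat.cast_add, Nat.cast_one, contDiffOn_succ_iff_derivWithin hT']
    refine ⟨fun t ht => (hd t ht).differentiableWithinAt, by simp, ?_⟩
    exact (ih hf').congr fun t ht => (hd t ht).derivWithin (hT' t ht)

/-- The Picard operator `u ↦ y₀ + ∫₀ᵗ F u` on functions on `[0, T]`. -/
noncomputable def picardMap {T : ℝ} (hT : 0 ≤ T) (y₀ : ℝ) (F : (ℝ → ℝ) → ℝ → ℝ)
    (hF : ∀ y, ContinuousOn y (Icc 0 T) → ContinuousOn (F y) (Icc 0 T))
    (u : C(Icc 0 T, ℝ)) : C(Icc 0 T, ℝ) where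
  toFun t := y₀ + ∫ s in (0:ℝ)..t, F (IccExtend hT u) s
  continuous_toFun := by
    have h : ContinuousOn (fun t => ∫ s in (0:ℝ)..t, F (IccExtend hT u) s) (Icc 0 T) := by
      have hi : IntervalIntegrable (F (IccExtend hT u)) volume 0 T :=
        (hF _ u.continuous.Icc_extend'.continuousOn).intervalIntegrable_of_Icc hT
      exact (intervalIntegral.continuousOn_primitive_interval' hi left_mem_uIcc).mono
        Icc_subset_uIcc
    exact continuous_const.add h.domRestrict

theorem abs_iterate_picardMap_sub_le {T : ℝ} (hT : 0 ≤ T) (y₀ : ℝ) (F : (ℝ → ℝ) → ℝ → ℝ)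
    (hF : ∀ y, ContinuousOn y (Icc 0 T) → ContinuousOn (F y) (Icc 0 T)) {L : ℝ} (hL : 0 ≤ L)
    (hlip : ∀ y z, ContinuousOn y (Icc 0 T) → ContinuousOn z (Icc 0 T) → ∀ t ∈ Icc 0 T, ∀ M,
      (∀ s ∈ Icc 0 t, |y s - z s| ≤ M) → |F y t - F z t| ≤ L * M)
    (u v : C(Icc 0 T, ℝ)) (n : ℕ) (t : Icc 0 T) :
    |(picardMap hT y₀ F hF)^[n] u t - (picardMap hT y₀ F hF)^[n] v t|
      ≤ (L * t) ^ n / n.factorial * dist u v := by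
  induction n generalizing t with
  | zero => simpa [Real.dist_eq] using ContinuousMap.dist_apply_le_dist (f := u) (g := v) t
  | succ n ih =>
    rw [Function.iterate_succ_apply', Function.iterate_succ_apply']
    generalize (picardMap hT y₀ F hF)^[n] u = a at ih
    generalize (picardMap hT y₀ F hF)^[n] v = b at ih
    obtain ⟨t, ht⟩ := t
    have hc : ∀ c : C(Icc 0 T, ℝ), ContinuousOn (IccExtend hT c) (Icc 0 T) := fun c =>
      c.continuous.Icc_extend'.continuousOn
    have hi : ∀ c : C(Icc 0 T, ℝ),
        IntervalIntegrable (F (IccExtend hT c)) volume 0 t := fun c => by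
      refine ContinuousOn.intervalIntegrable ?_
      rw [uIcc_of_le ht.1]
      exact (hF _ (hc c)).mono (Icc_subset_Icc_right ht.2)
    have hpt : ∀ s ∈ Icc 0 t, |F (IccExtend hT a) s - F (IccExtend hT b) s|
        ≤ L * ((L * s) ^ n / n.factorial * dist u v) := by
      intro s hs
      have hsT : s ∈ Icc 0 T := ⟨hs.1, hs.2.trans ht.2⟩
      refine hlip _ _ (hc a) (hc b) s hsT _ fun r hr => ?_
      have hrT : r ∈ Icc 0 T := ⟨hr.1, hr.2.trans hsT.2⟩
      rw [IccExtend_of_mem _ _ hrT, IccExtend_of_mem _ _ hrT]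
      refine (ih ⟨r, hrT⟩).trans ?_
      have h0 : 0 ≤ L * r := mul_nonneg hL hr.1
      have h1 : L * r ≤ L * s := mul_le_mul_of_nonneg_left hr.2 hL
      dsimp only
      gcongr
    calc |picardMap hT y₀ F hF a ⟨t, ht⟩ - picardMap hT y₀ F hF b ⟨t, ht⟩|
        = |∫ s in (0:ℝ)..t, (F (IccExtend hT a) s - F (IccExtend hT b) s)| := by
          rw [intervalIntegral.integral_sub (hi a) (hi b)]
          simp [picardMap]
      _ ≤ ∫ s in (0:ℝ)..t, |F (IccExtend hT a) s - F (IccExtend hT b) s| :=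
          intervalIntegral.abs_integral_le_integral_abs ht.1
      _ ≤ ∫ s in (0:ℝ)..t, L * ((L * s) ^ n / n.factorial * dist u v) :=
          intervalIntegral.integral_mono_on ht.1 ((hi a).sub (hi b)).abs
            (Continuous.intervalIntegrable (by fun_prop) _ _) hpt
      _ = (L * t) ^ (n + 1) / (n + 1).factorial * dist u v := by
          have h : ∀ s : ℝ, L * ((L * s) ^ n / n.factorial * dist u v)
              = L ^ (n + 1) / n.factorial * dist u v * s ^ n := fun s => by
            rw [mul_pow]; ring
          simp_rw [h]
          rw [intervalIntegral.integral_const_mul, integral_pow, Nat.factorial_succ]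
          push_cast
          field_simp
          simp
          ring

/-- Existence and uniqueness for a causal Lipschitz functional differential equation. -/
theorem exists_unique_causal_lipschitz_solution {T : ℝ} (hT : 0 < T) (y₀ : ℝ)
    (F : (ℝ → ℝ) → ℝ → ℝ)
    (hF : ∀ y, ContinuousOn y (Icc 0 T) → ContinuousOn (F y) (Icc 0 T)) {L : ℝ} (hL : 0 ≤ L)
    (hcongr : ∀ y z, EqOn y z (Icc 0 T) → EqOn (F y) (F z) (Icc 0 T))
    (hlip : ∀ y z, ContinuousOn y (Icc 0 T) → ContinuousOn z (Icc 0 T) → ∀ t ∈ Icc 0 T, ∀ M,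
      (∀ s ∈ Icc 0 t, |y s - z s| ≤ M) → |F y t - F z t| ≤ L * M) :
    ∃ y : ℝ → ℝ, (∀ t ∈ Icc 0 T, HasDerivWithinAt y (F y t) (Icc 0 T) t) ∧ y 0 = y₀ ∧
      ∀ z z' : ℝ → ℝ, ContinuousOn z' (Icc 0 T) →
        (∀ t ∈ Icc 0 T, HasDerivWithinAt z (z' t) (Icc 0 T) t) → z 0 = y₀ →
        (∀ t ∈ Ioc 0 T, z' t = F z t) → EqOn z y (Icc 0 T) := by
  have hT0 := hT.le
  set Φ := picardMap hT0 y₀ F hF with hΦ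
  obtain ⟨n, hn⟩ : ∃ n : ℕ, (L * T) ^ n / n.factorial < 1 :=
    ((FloorSemiring.tendsto_pow_div_factorial_atTop (L * T)).eventually
      (gt_mem_nhds one_pos)).exists
  have hq0 : 0 ≤ (L * T) ^ n / n.factorial := by positivity
  have hcontr : ContractingWith ⟨(L * T) ^ n / n.factorial, hq0⟩ Φ^[n] := by
    refine ⟨by exact_mod_cast hn, LipschitzWith.of_dist_le_mul fun u v => ?_⟩
    refine (ContinuousMap.dist_le (by positivity)).2 fun t => ?_
    rw [Real.dist_eq]
    refine (abs_iterate_picardMap_sub_le hT0 y₀ F hF hL hlip u v n t).trans ?_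
    have h0 : 0 ≤ L * (t : ℝ) := mul_nonneg hL t.2.1
    have h1 : L * (t : ℝ) ≤ L * T := mul_le_mul_of_nonneg_left t.2.2 hL
    change _ ≤ (L * T) ^ n / n.factorial * dist u v
    gcongr
  have hfix := hcontr.isFixedPt_fixedPoint_iterate
  set u := ContractingWith.fixedPoint Φ^[n] hcontr with hu
  have hyc : ContinuousOn (IccExtend hT0 u) (Icc 0 T) := u.continuous.Icc_extend'.continuousOn
  have hyeq : ∀ t ∈ Icc 0 T, IccExtend hT0 u t
      = y₀ + ∫ s in (0:ℝ)..t, F (IccExtend hT0 u) s := by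
    intro t ht
    have := congrArg (fun v : C(Icc 0 T, ℝ) => v ⟨t, ht⟩) hfix
    rw [IccExtend_of_mem _ _ ht]
    exact this.symm
  refine ⟨IccExtend hT0 u, fun t ht => ?_, ?_, fun z z' hz'c hz' hz0 hzF => ?_⟩
  · have hc := hF _ hyc
    have hi : IntervalIntegrable (F (IccExtend hT0 u)) volume 0 t := by
      refine ContinuousOn.intervalIntegrable ?_
      rw [uIcc_of_le ht.1]
      exact hc.mono (Icc_subset_Icc_right ht.2)
    have : Fact (t ∈ Icc 0 T) := ⟨ht⟩
    have hd : HasDerivWithinAt (fun t => y₀ + ∫ s in (0:ℝ)..t, F (IccExtend hT0 u) s)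
        (F (IccExtend hT0 u) t) (Icc 0 T) t :=
      (intervalIntegral.integral_hasDerivWithinAt_right hi
        (hc.stronglyMeasurableAtFilter_nhdsWithin measurableSet_Icc t) (hc t ht)).const_add y₀
    exact hd.congr hyeq (hyeq t ht)
  · rw [hyeq 0 ⟨le_rfl, hT0⟩]
    simp
  · have hzc : ContinuousOn z (Icc 0 T) := fun t ht => (hz' t ht).continuousWithinAt
    let v : C(Icc 0 T, ℝ) := ⟨(Icc 0 T).domRestrict z, hzc.domRestrict⟩
    have hvz : EqOn (IccExtend hT0 v) z (Icc 0 T) := fun t ht => by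
      rw [IccExtend_of_mem _ _ ht]; rfl
    have hv : Function.IsFixedPt Φ v := by
      ext ⟨t, ht⟩
      change y₀ + ∫ s in (0:ℝ)..t, F (IccExtend hT0 v) s = z t
      have hsub : Icc 0 t ⊆ Icc 0 T := Icc_subset_Icc_right ht.2
      have h1 : ∫ s in (0:ℝ)..t, F (IccExtend hT0 v) s = ∫ s in (0:ℝ)..t, z' s := by
        refine intervalIntegral.integral_congr_ae (Filter.Eventually.of_forall fun s hs => ?_)
        rw [uIoc_of_le ht.1] at hs
        rw [hzF s ⟨hs.1, hs.2.trans ht.2⟩]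
        exact hcongr _ _ hvz (hsub (Ioc_subset_Icc_self hs))
      have h2 : ∫ s in (0:ℝ)..t, z' s = z t - z 0 := by
        refine intervalIntegral.integral_eq_sub_of_hasDerivAt_of_le ht.1 (hzc.mono hsub)
          (fun s hs => (hz' s (hsub (Ioo_subset_Icc_self hs))).hasDerivAt
            (Icc_mem_nhds hs.1 (hs.2.trans_le ht.2))) ?_
        refine ContinuousOn.intervalIntegrable ?_
        rw [uIcc_of_le ht.1]
        exact hz'c.mono hsub
      rw [h1, h2, hz0]
      ring
    have hvu : v = u := hcontr.fixedPoint_unique (hv.iterate n)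
    intro t ht
    rw [← hvu]
    exact (hvz ht).symm

/-- The weight `(1 - x) ^ (-μ) * x ^ (μ + γ - 1)` of the rescaled cordial operator. -/
noncomputable def cordialWeight (μ γ x : ℝ) : ℝ := (1 - x) ^ (-μ) * x ^ (μ + γ - 1)

theorem intervalIntegrable_cordialWeight {μ γ : ℝ} (hμ : μ < 1) (hμγ : 1 ≤ μ + γ) :
    IntervalIntegrable (cordialWeight μ γ) volume 0 1 := by
  have h := (intervalIntegral.intervalIntegrable_rpow' (a := 1) (b := 0) (r := -μ)
    (by linarith)).comp_sub_left 1
  simp only [sub_self, sub_zero] at h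
  exact h.mul_continuousOn
    (continuousOn_id.rpow_const fun x _ => Or.inr (by linarith))

/-- The cordial operator with delay `δ`, rescaled to the unit interval. -/
noncomputable def rescaledCordial (μ γ δ : ℝ) (K : ℝ → ℝ → ℝ) (y : ℝ → ℝ) (t : ℝ) : ℝ :=
  ∫ x in (0:ℝ)..1, cordialWeight μ γ x * (K t (δ * t * x) * y (δ * t * x))

theorem cordial_integral_rescale {μ γ a : ℝ} (ha : 0 < a) (φ y : ℝ → ℝ) :
    a ^ (-γ) * (∫ s in (0:ℝ)..a, ((a - s) ^ (-μ) * s ^ (μ + γ - 1) * φ s * y s))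
      = ∫ x in (0:ℝ)..1, cordialWeight μ γ x * (φ (a * x) * y (a * x)) := by
  have h := intervalIntegral.mul_integral_comp_mul_left (a := 0) (b := 1)
    (f := fun s => (a - s) ^ (-μ) * s ^ (μ + γ - 1) * φ s * y s) a
  rw [mul_zero, mul_one] at h
  rw [← h, ← mul_assoc, ← intervalIntegral.integral_const_mul]
  refine intervalIntegral.integral_congr fun x hx => ?_
  rw [uIcc_of_le zero_le_one] at hx
  have h1 : (a - a * x) ^ (-μ) = a ^ (-μ) * (1 - x) ^ (-μ) := by
    rw [← Real.mul_rpow ha.le (sub_nonneg.2 hx.2)]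
    ring_nf
  have h2 : (a * x) ^ (μ + γ - 1) = a ^ (μ + γ - 1) * x ^ (μ + γ - 1) :=
    Real.mul_rpow ha.le hx.1
  have h3 : a ^ (-γ) * a * a ^ (-μ) * a ^ (μ + γ - 1) = 1 := by
    nth_rewrite 2 [← Real.rpow_one a]
    rw [← Real.rpow_add ha, ← Real.rpow_add ha, ← Real.rpow_add ha]
    ring_nf
    exact Real.rpow_zero a
  simp only [h1, h2, cordialWeight]
  calc _ = (a ^ (-γ) * a * a ^ (-μ) * a ^ (μ + γ - 1))
        * ((1 - x) ^ (-μ) * x ^ (μ + γ - 1) * (φ (a * x) * y (a * x))) := by ring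
    _ = _ := by rw [h3, one_mul]

section

variable {T μ γ δ : ℝ} {K : ℝ → ℝ → ℝ} {y z : ℝ → ℝ}

theorem delay_mem_Icc (hδ0 : 0 ≤ δ) (hδ1 : δ ≤ 1) {t x : ℝ} (ht : t ∈ Icc 0 T)
    (hx : x ∈ Icc (0:ℝ) 1) : δ * t * x ∈ Icc 0 t := by
  have h : δ * t ≤ t := mul_le_of_le_one_left ht.1 hδ1
  have h0 : 0 ≤ δ * t := mul_nonneg hδ0 ht.1
  exact ⟨mul_nonneg h0 hx.1, (mul_le_of_le_one_right h0 hx.2).trans h⟩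

theorem contDiffOn_cordial_integrand (hδ0 : 0 ≤ δ) (hδ1 : δ ≤ 1) {m : ℕ}
    (hK : ContDiffOn ℝ m (fun p : ℝ × ℝ => K p.1 p.2) (cordialTriangle T))
    (hy : ContDiffOn ℝ m y (Icc 0 T)) :
    ContDiffOn ℝ m (fun p : ℝ × ℝ => K p.1 (δ * p.1 * p.2) * y (δ * p.1 * p.2))
      (Icc 0 T ×ˢ Icc 0 1) := by
  have hs : ContDiffOn ℝ m (fun p : ℝ × ℝ => δ * p.1 * p.2) (Icc 0 T ×ˢ Icc 0 1) :=
    ContDiff.contDiffOn (by fun_prop)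
  have h1 : ContDiffOn ℝ m (fun p : ℝ × ℝ => K p.1 (δ * p.1 * p.2)) (Icc 0 T ×ˢ Icc 0 1) :=
    hK.comp (contDiffOn_fst.prodMk hs) fun p hp =>
      ⟨(delay_mem_Icc hδ0 hδ1 hp.1 hp.2).1, (delay_mem_Icc hδ0 hδ1 hp.1 hp.2).2, hp.1.2⟩
  have h2 : ContDiffOn ℝ m (fun p : ℝ × ℝ => y (δ * p.1 * p.2)) (Icc 0 T ×ˢ Icc 0 1) :=
    hy.comp hs fun p hp => Icc_subset_Icc_right hp.1.2 (delay_mem_Icc hδ0 hδ1 hp.1 hp.2)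
  exact h1.mul h2

theorem contDiffOn_rescaledCordial (hT : 0 < T) (hμ : μ < 1) (hμγ : 1 ≤ μ + γ)
    (hδ0 : 0 ≤ δ) (hδ1 : δ ≤ 1) {m : ℕ}
    (hK : ContDiffOn ℝ m (fun p : ℝ × ℝ => K p.1 p.2) (cordialTriangle T))
    (hy : ContDiffOn ℝ m y (Icc 0 T)) :
    ContDiffOn ℝ m (rescaledCordial μ γ δ K y) (Icc 0 T) :=
  contDiffOn_weighted_integral hT (intervalIntegrable_cordialWeight hμ hμγ) m
    (contDiffOn_cordial_integrand hδ0 hδ1 hK hy)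

theorem rescaledCordial_congr (hδ0 : 0 ≤ δ) (hδ1 : δ ≤ 1) (h : EqOn y z (Icc 0 T)) :
    EqOn (rescaledCordial μ γ δ K y) (rescaledCordial μ γ δ K z) (Icc 0 T) := by
  intro t ht
  refine intervalIntegral.integral_congr fun x hx => ?_
  rw [uIcc_of_le zero_le_one] at hx
  simp only [h (Icc_subset_Icc_right ht.2 (delay_mem_Icc hδ0 hδ1 ht hx))]

theorem isCompact_cordialTriangle (T : ℝ) : IsCompact (cordialTriangle T) := by
  refine (isCompact_Icc.prod isCompact_Icc).of_isClosed_subset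
    (s := Icc (0:ℝ) T ×ˢ Icc (0:ℝ) T) ?_ ?_
  · exact (isClosed_le continuous_const continuous_snd).inter
      ((isClosed_le continuous_snd continuous_fst).inter
        (isClosed_le continuous_fst continuous_const))
  · exact fun p hp => ⟨⟨hp.1.trans hp.2.1, hp.2.2⟩, ⟨hp.1, hp.2.1.trans hp.2.2⟩⟩

theorem exists_lipschitz_rescaledCordial (hμ : μ < 1) (hμγ : 1 ≤ μ + γ)
    (hδ0 : 0 ≤ δ) (hδ1 : δ ≤ 1)
    (hK : ContinuousOn (fun p : ℝ × ℝ => K p.1 p.2) (cordialTriangle T)) :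
    ∃ L, 0 ≤ L ∧ ∀ y z, ContinuousOn y (Icc 0 T) → ContinuousOn z (Icc 0 T) →
      ∀ t ∈ Icc 0 T, ∀ M, (∀ s ∈ Icc 0 t, |y s - z s| ≤ M) →
        |rescaledCordial μ γ δ K y t - rescaledCordial μ γ δ K z t| ≤ L * M := by
  obtain ⟨C, hC⟩ := (isCompact_cordialTriangle T).exists_bound_of_continuousOn hK
  have hw := intervalIntegrable_cordialWeight hμ hμγ
  refine ⟨(∫ x in (0:ℝ)..1, |cordialWeight μ γ x|) * |C|,
    mul_nonneg (intervalIntegral.integral_nonneg zero_le_one fun x _ => abs_nonneg _)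
      (abs_nonneg _), fun y z hy hz t ht M hM => ?_⟩
  have hi : ∀ y, ContinuousOn y (Icc 0 T) → IntervalIntegrable
      (fun x => cordialWeight μ γ x * (K t (δ * t * x) * y (δ * t * x))) volume 0 1 := by
    intro y hy
    have h := (contDiffOn_cordial_integrand (m := 0) hδ0 hδ1 (contDiffOn_zero.2 hK)
      (contDiffOn_zero.2 hy)).continuousOn
    refine hw.mul_continuousOn ?_
    rw [uIcc_of_le zero_le_one]
    exact h.comp (f := fun x => (t, x)) (by fun_prop) fun x hx => ⟨ht, hx⟩
  unfold rescaledCordial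
  rw [← intervalIntegral.integral_sub (hi y hy) (hi z hz), mul_assoc,
    ← intervalIntegral.integral_mul_const]
  refine (intervalIntegral.abs_integral_le_integral_abs zero_le_one).trans
    (intervalIntegral.integral_mono_on zero_le_one ((hi y hy).sub (hi z hz)).abs
      (hw.abs.mul_const _) fun x hx => ?_)
  have hd := delay_mem_Icc hδ0 hδ1 ht hx
  rw [← mul_sub, ← mul_sub, abs_mul, abs_mul]
  have h1 : |K t (δ * t * x)| ≤ |C| :=
    (hC (t, δ * t * x) ⟨hd.1, hd.2, ht.2⟩).trans (le_abs_self C)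
  have h2 := hM _ hd
  gcongr

end

/-- The right-hand side of the equation with both cordial operators rescaled. -/
noncomputable def rescaledRHS (μ γ ε : ℝ) (p₁ q₁ g₁ : ℝ → ℝ) (K₁ K₂ : ℝ → ℝ → ℝ)
    (y : ℝ → ℝ) (t : ℝ) : ℝ :=
  p₁ t * y t + q₁ t * y (ε * t) + g₁ t + rescaledCordial μ γ 1 K₁ y t
    + rescaledCordial μ γ ε K₂ y t

theorem cordialRHS_eq_rescaledRHS {μ γ ε : ℝ} (hε : 0 < ε) (p₁ q₁ g₁ : ℝ → ℝ)
    (K₁ K₂ : ℝ → ℝ → ℝ) (y : ℝ → ℝ) {t : ℝ} (ht : 0 < t) :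
    cordialRHS μ γ ε p₁ q₁ g₁ K₁ K₂ y t = rescaledRHS μ γ ε p₁ q₁ g₁ K₁ K₂ y t := by
  unfold cordialRHS rescaledRHS rescaledCordial
  rw [cordial_integral_rescale ht, cordial_integral_rescale (mul_pos hε ht)]
  simp only [one_mul]

section

variable {T μ γ ε : ℝ} {p₁ q₁ g₁ : ℝ → ℝ} {K₁ K₂ : ℝ → ℝ → ℝ} {y z : ℝ → ℝ}

theorem mul_mem_Icc_of_le_one (hε0 : 0 ≤ ε) (hε1 : ε ≤ 1) {t : ℝ} (ht : t ∈ Icc 0 T) :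
    ε * t ∈ Icc 0 t :=
  ⟨mul_nonneg hε0 ht.1, mul_le_of_le_one_left ht.1 hε1⟩

theorem contDiffOn_rescaledRHS (hT : 0 < T) (hμ : μ < 1) (hμγ : 1 ≤ μ + γ)
    (hε0 : 0 ≤ ε) (hε1 : ε ≤ 1) {m : ℕ}
    (hp : ContDiffOn ℝ m p₁ (Icc 0 T)) (hq : ContDiffOn ℝ m q₁ (Icc 0 T))
    (hg : ContDiffOn ℝ m g₁ (Icc 0 T))
    (hK₁ : ContDiffOn ℝ m (fun p : ℝ × ℝ => K₁ p.1 p.2) (cordialTriangle T))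
    (hK₂ : ContDiffOn ℝ m (fun p : ℝ × ℝ => K₂ p.1 p.2) (cordialTriangle T))
    (hy : ContDiffOn ℝ m y (Icc 0 T)) :
    ContDiffOn ℝ m (rescaledRHS μ γ ε p₁ q₁ g₁ K₁ K₂ y) (Icc 0 T) := by
  have hyε : ContDiffOn ℝ m (fun t => y (ε * t)) (Icc 0 T) :=
    hy.comp (f := fun t => ε * t) (ContDiff.contDiffOn (by fun_prop)) fun t ht =>
      Icc_subset_Icc_right ht.2 (mul_mem_Icc_of_le_one hε0 hε1 ht)
  exact ((((hp.mul hy).add (hq.mul hyε)).add hg).add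
    (contDiffOn_rescaledCordial hT hμ hμγ zero_le_one le_rfl hK₁ hy)).add
    (contDiffOn_rescaledCordial hT hμ hμγ hε0 hε1 hK₂ hy)

theorem rescaledRHS_congr (hε0 : 0 ≤ ε) (hε1 : ε ≤ 1) (h : EqOn y z (Icc 0 T)) :
    EqOn (rescaledRHS μ γ ε p₁ q₁ g₁ K₁ K₂ y) (rescaledRHS μ γ ε p₁ q₁ g₁ K₁ K₂ z)
      (Icc 0 T) := by
  intro t ht
  simp only [rescaledRHS, h ht,
    h (Icc_subset_Icc_right ht.2 (mul_mem_Icc_of_le_one hε0 hε1 ht)),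
    rescaledCordial_congr zero_le_one le_rfl h ht, rescaledCordial_congr hε0 hε1 h ht]

theorem exists_lipschitz_rescaledRHS (hμ : μ < 1) (hμγ : 1 ≤ μ + γ)
    (hε0 : 0 ≤ ε) (hε1 : ε ≤ 1)
    (hp : ContinuousOn p₁ (Icc 0 T)) (hq : ContinuousOn q₁ (Icc 0 T))
    (hK₁ : ContinuousOn (fun p : ℝ × ℝ => K₁ p.1 p.2) (cordialTriangle T))
    (hK₂ : ContinuousOn (fun p : ℝ × ℝ => K₂ p.1 p.2) (cordialTriangle T)) :
    ∃ L, 0 ≤ L ∧ ∀ y z, ContinuousOn y (Icc 0 T) → ContinuousOn z (Icc 0 T) →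
      ∀ t ∈ Icc 0 T, ∀ M, (∀ s ∈ Icc 0 t, |y s - z s| ≤ M) →
        |rescaledRHS μ γ ε p₁ q₁ g₁ K₁ K₂ y t - rescaledRHS μ γ ε p₁ q₁ g₁ K₁ K₂ z t|
          ≤ L * M := by
  obtain ⟨P, hP⟩ := isCompact_Icc.exists_bound_of_continuousOn hp
  obtain ⟨Q, hQ⟩ := isCompact_Icc.exists_bound_of_continuousOn hq
  obtain ⟨L₁, hL₁, h₁⟩ := exists_lipschitz_rescaledCordial hμ hμγ zero_le_one le_rfl hK₁
  obtain ⟨L₂, hL₂, h₂⟩ := exists_lipschitz_rescaledCordial hμ hμγ hε0 hε1 hK₂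
  refine ⟨|P| + |Q| + L₁ + L₂, by positivity, fun y z hy hz t ht M hM => ?_⟩
  have e₁ := h₁ y z hy hz t ht M hM
  have e₂ := h₂ y z hy hz t ht M hM
  have e₃ : |p₁ t * (y t - z t)| ≤ |P| * M := by
    rw [abs_mul]
    exact mul_le_mul ((hP t ht).trans (le_abs_self P)) (hM t ⟨ht.1, le_rfl⟩)
      (abs_nonneg _) (abs_nonneg _)
  have e₄ : |q₁ t * (y (ε * t) - z (ε * t))| ≤ |Q| * M := by
    rw [abs_mul]
    exact mul_le_mul ((hQ t ht).trans (le_abs_self Q))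
      (hM _ (mul_mem_Icc_of_le_one hε0 hε1 ht)) (abs_nonneg _) (abs_nonneg _)
  rw [abs_le] at e₁ e₂ e₃ e₄ ⊢
  unfold rescaledRHS
  constructor <;> linarith [e₁.1, e₁.2, e₂.1, e₂.2, e₃.1, e₃.2, e₄.1, e₄.2]

end

/-- Existence, uniqueness and regularity of the `C¹` solution of the third-kind weakly singular
Volterra integro-differential equation with proportional delay. -/
theorem existence_uniqueness_cordial_VIDE
    (T μ γ ε y₀ : ℝ) (hT : 0 < T) (hμ0 : 0 ≤ μ) (hμ1 : μ < 1)
    (hγ : 0 < γ) (hμγ : 1 ≤ μ + γ) (hε0 : 0 < ε) (hε1 : ε ≤ 1)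
    (p₁ q₁ g₁ : ℝ → ℝ) (K₁ K₂ : ℝ → ℝ → ℝ)
    (hp : ContinuousOn p₁ (Icc 0 T)) (hq : ContinuousOn q₁ (Icc 0 T))
    (hg : ContinuousOn g₁ (Icc 0 T))
    (hK₁ : ContinuousOn (fun p : ℝ × ℝ => K₁ p.1 p.2) (cordialTriangle T))
    (hK₂ : ContinuousOn (fun p : ℝ × ℝ => K₂ p.1 p.2) (cordialTriangle T)) :
    ∃ y : ℝ → ℝ, IsCordialSolution μ γ ε y₀ T p₁ q₁ g₁ K₁ K₂ y ∧
      (∀ z : ℝ → ℝ, IsCordialSolution μ γ ε y₀ T p₁ q₁ g₁ K₁ K₂ z →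
        EqOn z y (Icc 0 T)) ∧
      (∀ m : ℕ,
        ContDiffOn ℝ m p₁ (Icc 0 T) → ContDiffOn ℝ m q₁ (Icc 0 T) →
        ContDiffOn ℝ m g₁ (Icc 0 T) →
        ContDiffOn ℝ m (fun p : ℝ × ℝ => K₁ p.1 p.2) (cordialTriangle T) →
        ContDiffOn ℝ m (fun p : ℝ × ℝ => K₂ p.1 p.2) (cordialTriangle T) →
        ContDiffOn ℝ (m + 1) y (Icc 0 T)) := by
  obtain ⟨L, hL, hlip⟩ := exists_lipschitz_rescaledRHS (g₁ := g₁) hμ1 hμγ hε0.le hε1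
    hp hq hK₁ hK₂
  have hcont : ∀ y, ContinuousOn y (Icc 0 T) →
      ContinuousOn (rescaledRHS μ γ ε p₁ q₁ g₁ K₁ K₂ y) (Icc 0 T) := fun y hy =>
    (contDiffOn_rescaledRHS (m := 0) hT hμ1 hμγ hε0.le hε1 (contDiffOn_zero.2 hp)
      (contDiffOn_zero.2 hq) (contDiffOn_zero.2 hg) (contDiffOn_zero.2 hK₁)
      (contDiffOn_zero.2 hK₂) (contDiffOn_zero.2 hy)).continuousOn
  obtain ⟨y, hy, hy0, huniq⟩ := exists_unique_causal_lipschitz_solution hT y₀ _ hcont hL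
    (fun _ _ => rescaledRHS_congr hε0.le hε1) hlip
  have hyc : ContinuousOn y (Icc 0 T) := fun t ht => (hy t ht).continuousWithinAt
  refine ⟨y, ⟨_, hcont y hyc, hy, hy0, fun t ht =>
    (cordialRHS_eq_rescaledRHS hε0 p₁ q₁ g₁ K₁ K₂ y ht.1).symm⟩, ?_, ?_⟩
  · rintro z ⟨z', hz'c, hz', hz0, hzF⟩
    exact huniq z z' hz'c hz' hz0 fun t ht =>
      (hzF t ht).trans (cordialRHS_eq_rescaledRHS hε0 p₁ q₁ g₁ K₁ K₂ z ht.1)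
  · intro m hp hq hg hK₁ hK₂
    have hU : UniqueDiffOn ℝ (Icc 0 T) := uniqueDiffOn_Icc hT
    have step : ∀ k : ℕ, k ≤ m → ContDiffOn ℝ k y (Icc 0 T) →
        ContDiffOn ℝ (k + 1) y (Icc 0 T) := by
      intro k hk hyk
      have hkm : (k : WithTop ℕ∞) ≤ m := by exact_mod_cast hk
      rw [contDiffOn_succ_iff_derivWithin hU]
      refine ⟨fun t ht => (hy t ht).differentiableWithinAt, by simp, ?_⟩
      exact (contDiffOn_rescaledRHS hT hμ1 hμγ hε0.le hε1 (hp.of_le hkm) (hq.of_le hkm)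
        (hg.of_le hkm) (hK₁.of_le hkm) (hK₂.of_le hkm) hyk).congr
        fun t ht => (hy t ht).derivWithin (hU t ht)
    have hreg : ∀ k : ℕ, k ≤ m → ContDiffOn ℝ k y (Icc 0 T) := by
      intro k
      induction k with
      | zero => exact fun _ => contDiffOn_zero.2 hyc
      | succ k ih =>
        intro hk
        have hk' : k ≤ m := by omega
        exact_mod_cast step k hk' (ih hk')
    exact step m le_rfl (hreg m le_rfl)
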